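/- arXiv:1207.1267 — 3 statements merged into one kernel-verified Lean document; each statement's English description precedes it below -/
import Mathlib

section
/- Let α : ℝ → ℝ be a function of bounded variation on ℝ with compact support, and let φⁿ solve dφ_tⁿ(x) = αₙ(φ_tⁿ(x))dt + dw(t), φ_0ⁿ(x) = x, where αₙ is the mollification of α. Set ψ_tⁿ(x) = exp{∫_0^t αₙ'(φ_sⁿ(x)) ds}, which is the derivative of φ_tⁿ(x) with respect to x. Then for every p ≥ 1 and t ≥ 0, sup_{n≥1, x∈ℝ} E|ψ_tⁿ(x)|^p < ∞. -/
open MeasureTheory ProbabilityTheory Filter Set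

noncomputable section

/-- The σ-algebra generated by the process `w` up to time `t` (natural filtration). -/
def natSigma {Ω : Type*} [MeasurableSpace Ω] (w : ℝ → Ω → ℝ) (t : ℝ) : MeasurableSpace Ω :=
  ⨆ s ∈ Set.Icc (0:ℝ) t, MeasurableSpace.comap (w s) inferInstance

/-- `w` is a one-dimensional Wiener process (Brownian motion) on `[0,∞)`:
continuous paths started at `0`, Gaussian increments `w t - w s ~ N(0, t-s)`,
and increments independent of the past. -/
structure IsWiener {Ω : Type*} [MeasureSpace Ω] (w : ℝ → Ω → ℝ) : Prop where
  isProb : IsProbabilityMeasure (ℙ : Measure Ω)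
  meas : ∀ t : ℝ, Measurable (w t)
  init : ∀ᵐ ω ∂(ℙ : Measure Ω), w 0 ω = 0
  cont : ∀ᵐ ω ∂(ℙ : Measure Ω), Continuous fun t => w t ω
  gauss : ∀ s t : ℝ, 0 ≤ s → s ≤ t →
    Measure.map (fun ω => w t ω - w s ω) ℙ = gaussianReal 0 ((t - s).toNNReal)
  indep : ∀ s t : ℝ, 0 ≤ s → s ≤ t →
    Indep (MeasurableSpace.comap (fun ω => w t ω - w s ω) inferInstance) (natSigma w s) ℙ

/-- `φ` is a strong solution of the SDE `dφ_t = α(φ_t) dt + dw(t)`, `φ_0 = x`: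
it is adapted to the natural filtration of `w`, has continuous paths, and satisfies
the corresponding integral equation `φ_t = x + ∫_0^t α(φ_s) ds + w_t`. -/
structure IsStrongSolution {Ω : Type*} [MeasureSpace Ω] (α : ℝ → ℝ) (w : ℝ → Ω → ℝ)
    (x : ℝ) (φ : ℝ → Ω → ℝ) : Prop where
  adapted : ∀ t : ℝ, 0 ≤ t → @Measurable Ω ℝ (natSigma w t) _ (φ t)
  init : ∀ ω, φ 0 ω = x
  cont : ∀ᵐ ω ∂(ℙ : Measure Ω), ContinuousOn (fun t => φ t ω) (Set.Ici 0)
  sde : ∀ᵐ ω ∂(ℙ : Measure Ω), ∀ t : ℝ, 0 ≤ t →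
    φ t ω = x + (∫ s in (0:ℝ)..t, α (φ s ω)) + w t ω

/-- `L` is the local time of the path `X` at level `y` up to time `t`:
`L = lim_{ε↓0} (1/ε) ∫_0^t 1_{[y,y+ε)}(X_s) ds`. -/
def IsLocalTime (X : ℝ → ℝ) (y t L : ℝ) : Prop :=
  Filter.Tendsto
    (fun ε : ℝ => (1/ε) * ∫ s in (0:ℝ)..t,
      Set.indicator (Set.Ico y (y + ε)) (fun _ => (1:ℝ)) (X s))
    (nhdsWithin 0 (Set.Ioi 0)) (nhds L)

/-- Condition (A): `α` has bounded variation on each compact subset of `ℝ`. -/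
def CondA (α : ℝ → ℝ) : Prop := ∀ a b : ℝ, BoundedVariationOn α (Set.Icc a b)

/-- Condition (B): linear growth, `|α x|² ≤ C (1 + |x|²)` for some `C > 0`. -/
def CondB (α : ℝ → ℝ) : Prop := ∃ C > 0, ∀ x : ℝ, |α x| ^ 2 ≤ C * (1 + |x| ^ 2)

/-- Condition (C): `α` has bounded variation on all of `ℝ`. -/
def CondC (α : ℝ → ℝ) : Prop := BoundedVariationOn α Set.univ

/-- `g` is a sequence of mollifiers: `g n` is a `C¹` nonnegative function vanishing
outside `(-1/n, 1/n)` with total integral `1`. -/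
def IsMollifier (g : ℕ → ℝ → ℝ) : Prop :=
  ∀ n : ℕ, 1 ≤ n → ContDiff ℝ 1 (g n) ∧ (∀ x, 0 ≤ g n x) ∧
    (∀ x : ℝ, x ∉ Set.Ioo (-(1/(n:ℝ))) (1/(n:ℝ)) → g n x = 0) ∧ (∫ z, g n z) = 1

/-- The mollification `αₙ(x) = ∫_ℝ gₙ(x-y) α(y) dy`. -/
def mollify (g : ℕ → ℝ → ℝ) (α : ℝ → ℝ) (n : ℕ) (x : ℝ) : ℝ := ∫ y, g n (x - y) * α y

/-- First order Taylor estimate for a function with bounded second derivative. -/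
lemma abs_taylor_one_le {u u' u'' : ℝ → ℝ} (hu : ∀ y, HasDerivAt u (u' y) y)
    (hu' : ∀ y, HasDerivAt u' (u'' y) y) {C : ℝ} (hC : ∀ y, |u'' y| ≤ C) (y z : ℝ) :
    |u (y + z) - u y - u' y * z| ≤ C * z ^ 2 := by
  have hC0 : 0 ≤ C := (abs_nonneg _).trans (hC 0)
  have hlip : ∀ a b, |u' b - u' a| ≤ C * |b - a| := fun a b =>
    convex_univ.norm_image_sub_le_of_norm_hasDerivWithin_le (f := u') (f' := u'')
      (fun x _ => (hu' x).hasDerivWithinAt) (fun x _ => hC x) (mem_univ a) (mem_univ b)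
  have hd : ∀ r, HasDerivAt (fun r => u (y + r) - u' y * r) (u' (y + r) - u' y) r := fun r => by
    have h1 : HasDerivAt (fun r => u (y + r)) (u' (y + r)) r := by
      simpa using (hu (y + r)).comp_const_add y r
    exact (h1.sub ((hasDerivAt_id r).const_mul (u' y))).congr_deriv (by simp)
  have key := (convex_uIcc 0 z).norm_image_sub_le_of_norm_hasDerivWithin_le (C := C * |z|)
    (fun r _ => (hd r).hasDerivWithinAt) (fun r hr => by
      refine (hlip y (y + r)).trans ?_
      have : |r| ≤ |z| := by simpa using abs_sub_left_of_mem_uIcc hr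
      simpa using mul_le_mul_of_nonneg_left this hC0) left_mem_uIcc right_mem_uIcc
  simp only [Real.norm_eq_abs, add_zero, mul_zero, sub_zero] at key
  calc |u (y + z) - u y - u' y * z| = |u (y + z) - u' y * z - u y| := by ring_nf
    _ ≤ C * |z| * |z| := key
    _ = C * z ^ 2 := by rw [mul_assoc, abs_mul_abs_self, sq]

/-- Second order Taylor expansion, along `z ↦ √v * z` as `v ↓ 0`. -/
lemma tendsto_taylor_two_sqrt {u u' u'' : ℝ → ℝ} (hu : ∀ y, HasDerivAt u (u' y) y)
    (hu' : ∀ y, HasDerivAt u' (u'' y) y) (y z : ℝ) :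
    Tendsto (fun v : ℝ => v⁻¹ * (u (y + √v * z) - u y - u' y * (√v * z)))
      (nhdsWithin 0 (Ioi 0)) (nhds (u'' y / 2 * z ^ 2)) := by
  have hd : ∀ r, HasDerivAt (fun r => u (y + r) - u' y * r - u'' y / 2 * r ^ 2)
      (u' (y + r) - u' y - u'' y * r) r := fun r => by
    have h1 : HasDerivAt (fun r => u (y + r)) (u' (y + r)) r := by
      simpa using (hu (y + r)).comp_const_add y r
    refine ((h1.sub ((hasDerivAt_id r).const_mul (u' y))).sub
      ((hasDerivAt_pow 2 r).const_mul (u'' y / 2))).congr_deriv ?_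
    simp
    ring
  have hlit : (fun r => u (y + r) - u y - u' y * r - u'' y / 2 * r ^ 2)
      =o[nhds 0] fun r : ℝ => r ^ 2 := by
    rw [Asymptotics.isLittleO_iff]
    intro ε hε
    have h2 := (hasDerivAt_iff_isLittleO_nhds_zero.1 (hu' y)).def hε
    obtain ⟨η, hη, hη'⟩ := Metric.eventually_nhds_iff_ball.1 h2
    filter_upwards [Metric.ball_mem_nhds 0 hη] with r hr
    have key := (convex_uIcc 0 r).norm_image_sub_le_of_norm_hasDerivWithin_le (C := ε * |r|)
      (fun q _ => (hd q).hasDerivWithinAt) (fun q hq => by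
        have hqr : |q| ≤ |r| := by simpa using abs_sub_left_of_mem_uIcc hq
        have := hη' q (by
          rw [mem_ball_zero_iff] at hr ⊢
          exact hqr.trans_lt hr)
        rw [smul_eq_mul, mul_comm q] at this
        exact this.trans (mul_le_mul_of_nonneg_left hqr hε.le)) left_mem_uIcc right_mem_uIcc
    simp only [Real.norm_eq_abs, add_zero, mul_zero, sub_zero] at key ⊢
    calc _ = |u (y + r) - u' y * r - u'' y / 2 * r ^ 2 - (u y - u'' y / 2 * 0 ^ 2)| := by
          congr 1; ring
      _ ≤ ε * |r| * |r| := key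
      _ = ε * |r ^ 2| := by rw [mul_assoc, abs_mul_abs_self, sq, abs_mul_self]
  have hsqrt : Tendsto (fun v : ℝ => √v * z) (nhdsWithin 0 (Ioi 0)) (nhds 0) := by
    have : Continuous fun v : ℝ => √v * z := by fun_prop
    simpa using (this.tendsto 0).mono_left nhdsWithin_le_nhds
  have h3 := hlit.comp_tendsto hsqrt
  have h4 : (fun v : ℝ => u (y + √v * z) - u y - u' y * (√v * z) - u'' y / 2 * (√v * z) ^ 2)
      =o[nhdsWithin 0 (Ioi 0)] fun v : ℝ => v := by
    refine h3.trans_isBigO (Asymptotics.IsBigO.of_bound (z ^ 2) ?_)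
    filter_upwards [self_mem_nhdsWithin] with v hv
    have hv : 0 < v := hv
    simp only [Function.comp, Real.norm_eq_abs, mul_pow, Real.sq_sqrt hv.le]
    rw [abs_mul, abs_of_nonneg (sq_nonneg z), mul_comm]
  have h5 := h4.tendsto_div_nhds_zero.add_const (u'' y / 2 * z ^ 2)
  rw [zero_add] at h5
  refine h5.congr' ?_
  filter_upwards [self_mem_nhdsWithin] with v hv
  have hv : 0 < v := hv
  rw [mul_pow, Real.sq_sqrt hv.le]
  field_simp
  ring

lemma integral_sq_gaussianReal_zero_one : ∫ z, z ^ 2 ∂(gaussianReal 0 1) = 1 := by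
  have h := variance_fun_id_gaussianReal (μ := 0) (v := 1)
  rw [variance_eq_integral (by fun_prop)] at h
  simpa using h

lemma integrable_sq_gaussianReal_zero_one :
    Integrable (fun z : ℝ => z ^ 2) (gaussianReal 0 1) :=
  (memLp_id_gaussianReal 2).integrable_sq

lemma integrable_id_gaussianReal_zero_one : Integrable (fun z : ℝ => z) (gaussianReal 0 1) :=
  (memLp_id_gaussianReal 1).integrable (by simp)

/-- The heat semigroup increment `∫ u (y + z) dN(0, v)(z) - u y`, written on the standard
Gaussian with the (centered) first order term subtracted. -/
lemma integral_gaussianReal_increment {u : ℝ → ℝ} (hu : Continuous u) {B : ℝ}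
    (hB : ∀ y, |u y| ≤ B) (a y : ℝ) {v : ℝ} (hv : 0 ≤ v) :
    (∫ z, (u (y + z) - u y) ∂(gaussianReal 0 v.toNNReal)) =
      ∫ z, (u (y + √v * z) - u y - a * (√v * z)) ∂(gaussianReal 0 1) := by
  have hmap : (gaussianReal 0 1).map (√v * ·) = gaussianReal 0 v.toNNReal := by
    rw [gaussianReal_map_const_mul, mul_zero, mul_one]
    congr 1
    ext
    simp [Real.sq_sqrt hv, hv]
  rw [← hmap, integral_map (by fun_prop) (by fun_prop),
    integral_sub (f := fun z => u (y + √v * z) - u y) (g := fun z => a * (√v * z))]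
  · rw [integral_const_mul, integral_const_mul, integral_id_gaussianReal]
    simp
  · refine Integrable.of_bound (by fun_prop) (B + B) (ae_of_all _ fun z => ?_)
    exact (norm_sub_le _ _).trans (add_le_add (hB _) (hB _))
  · exact (integrable_id_gaussianReal_zero_one.const_mul _).const_mul _

lemma abs_integral_gaussianReal_increment_le {u u' u'' : ℝ → ℝ}
    (hu : ∀ y, HasDerivAt u (u' y) y) (hu' : ∀ y, HasDerivAt u' (u'' y) y) {B C : ℝ}
    (hB : ∀ y, |u y| ≤ B) (hC : ∀ y, |u'' y| ≤ C) (y : ℝ) {v : ℝ} (hv : 0 ≤ v) :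
    |∫ z, (u (y + z) - u y) ∂(gaussianReal 0 v.toNNReal)| ≤ C * v := by
  have hc : Continuous u := continuous_iff_continuousAt.2 fun y => (hu y).continuousAt
  rw [integral_gaussianReal_increment hc hB (u' y) y hv]
  have h := norm_integral_le_of_norm_le (μ := gaussianReal 0 1)
    (f := fun z => u (y + √v * z) - u y - u' y * (√v * z)) (g := fun z => C * v * z ^ 2)
    (integrable_sq_gaussianReal_zero_one.const_mul _) (ae_of_all _ fun z => by
      have := abs_taylor_one_le hu hu' hC y (√v * z)
      rwa [mul_pow, Real.sq_sqrt hv, ← mul_assoc C] at this)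
  rwa [integral_const_mul, integral_sq_gaussianReal_zero_one, mul_one] at h

lemma tendsto_integral_gaussianReal_increment {u u' u'' : ℝ → ℝ}
    (hu : ∀ y, HasDerivAt u (u' y) y) (hu' : ∀ y, HasDerivAt u' (u'' y) y) {B C : ℝ}
    (hB : ∀ y, |u y| ≤ B) (hC : ∀ y, |u'' y| ≤ C) (y : ℝ) :
    Tendsto (fun v : ℝ => v⁻¹ * ∫ z, (u (y + z) - u y) ∂(gaussianReal 0 v.toNNReal))
      (nhdsWithin 0 (Ioi 0)) (nhds (u'' y / 2)) := by
  have hc : Continuous u := continuous_iff_continuousAt.2 fun y => (hu y).continuousAt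
  have h : Tendsto (fun v : ℝ => ∫ z, v⁻¹ * (u (y + √v * z) - u y - u' y * (√v * z))
      ∂(gaussianReal 0 1)) (nhdsWithin 0 (Ioi 0))
      (nhds (∫ z, u'' y / 2 * z ^ 2 ∂(gaussianReal 0 1))) := by
    refine tendsto_integral_filter_of_dominated_convergence (fun z => C * z ^ 2)
      (Eventually.of_forall fun v => by fun_prop) ?_
      (integrable_sq_gaussianReal_zero_one.const_mul _)
      (ae_of_all _ fun z => tendsto_taylor_two_sqrt hu hu' y z)
    filter_upwards [self_mem_nhdsWithin] with v hv
    have hv : 0 < v := hv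
    refine ae_of_all _ fun z => ?_
    have := abs_taylor_one_le hu hu' hC y (√v * z)
    rw [mul_pow, Real.sq_sqrt hv.le] at this
    rw [Real.norm_eq_abs, abs_mul, abs_of_pos (inv_pos.2 hv), inv_mul_le_iff₀ hv]
    linarith
  rw [integral_const_mul, integral_sq_gaussianReal_zero_one, mul_one] at h
  refine h.congr' ?_
  filter_upwards [self_mem_nhdsWithin] with v hv
  rw [integral_gaussianReal_increment hc hB (u' y) y (le_of_lt hv), integral_const_mul]

/-- Integrating out an independent variable. -/
lemma integral_prod_of_indepFun {Ω β γ : Type*} [MeasurableSpace Ω] [MeasurableSpace β]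
    [MeasurableSpace γ] {μ : Measure Ω} [IsProbabilityMeasure μ] {X : Ω → β} {Y : Ω → γ}
    (hX : Measurable X) (hY : Measurable Y) (hXY : IndepFun X Y μ) {F : β × γ → ℝ}
    (hF : Measurable F) {B : ℝ} (hB : ∀ q, |F q| ≤ B) :
    ∫ ω, F (X ω, Y ω) ∂μ = ∫ ω, ∫ z, F (X ω, z) ∂(μ.map Y) ∂μ := by
  have : IsProbabilityMeasure (μ.map X) := Measure.isProbabilityMeasure_map hX.aemeasurable
  have : IsProbabilityMeasure (μ.map Y) := Measure.isProbabilityMeasure_map hY.aemeasurable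
  have hprod := (indepFun_iff_map_prod_eq_prod_map_map hX.aemeasurable hY.aemeasurable).1 hXY
  rw [← integral_map (φ := fun ω => (X ω, Y ω)) (by fun_prop) hF.aestronglyMeasurable, hprod,
    integral_prod _ (Integrable.of_bound hF.aestronglyMeasurable B (ae_of_all _ hB)),
    integral_map hX.aemeasurable]
  exact hF.stronglyMeasurable.integral_prod_right'.aestronglyMeasurable

/-- The time integral of a bounded process, all of whose values up to time `s` are measurable,
agrees on continuous paths with a measurable random variable. -/
lemma exists_measurable_eq_intervalIntegral {Ω : Type*} {m : MeasurableSpace Ω} {X : ℝ → Ω → ℝ}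
    {s L : ℝ} (hs : 0 ≤ s) (hX : ∀ r ∈ Icc 0 s, Measurable (X r)) (hL : ∀ r ω, |X r ω| ≤ L) :
    ∃ H : Ω → ℝ, Measurable H ∧
      ∀ ω, ContinuousOn (fun r => X r ω) (Ici 0) → H ω = ∫ r in (0:ℝ)..s, X r ω := by
  let grid : ℕ → ℝ → ℝ := fun N r => min ((⌊r * N⌋₊ : ℝ) / N) s
  have hgrid : ∀ N r, grid N r ∈ Icc 0 s := fun N r => ⟨le_min (by positivity) hs, min_le_right _ _⟩
  have hmeas : ∀ N, Measurable fun q : Ω × ℝ => X (grid N q.2) q.1 := fun N => by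
    have h1 : Measurable fun q : Ω × ℕ => X (min ((q.2 : ℝ) / N) s) q.1 :=
      measurable_from_prod_countable_left fun k =>
        hX (min ((k : ℝ) / N) s) ⟨le_min (by positivity) hs, min_le_right _ _⟩
    have h2 : Measurable fun q : Ω × ℝ => (q.1, ⌊q.2 * N⌋₊) :=
      measurable_fst.prodMk (Nat.measurable_floor.comp (measurable_snd.mul_const _))
    exact h1.comp h2
  have hint : ∀ N, Measurable fun ω => ∫ r in (0:ℝ)..s, X (grid N r) ω := fun N => by
    simp only [intervalIntegral.integral_of_le hs]
    exact (hmeas N).stronglyMeasurable.integral_prod_right'.measurable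
  refine ⟨_, Measurable.limsup hint, fun ω hω => Tendsto.limsup_eq ?_⟩
  refine intervalIntegral.tendsto_integral_filter_of_dominated_convergence (fun _ => L)
    (Eventually.of_forall fun N => ?_) (Eventually.of_forall fun N => ae_of_all _ fun r _ => hL _ _)
    intervalIntegrable_const (ae_of_all _ fun r hr => ?_)
  · exact ((hmeas N).comp measurable_prodMk_left).aestronglyMeasurable
  · rw [uIoc_of_le hs] at hr
    have h1 : Tendsto (fun N : ℕ => grid N r) atTop (nhds r) := by
      have := ((tendsto_nat_floor_mul_div_atTop hr.1.le).comp
        (tendsto_natCast_atTop_atTop (R := ℝ))).min (tendsto_const_nhds (x := s))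
      rwa [min_eq_left hr.2] at this
    exact (hω r hr.1.le).tendsto.comp (tendsto_nhdsWithin_iff.2
      ⟨h1, Eventually.of_forall fun N => (hgrid N r).1⟩)

lemma natSigma_le {Ω : Type*} [mΩ : MeasurableSpace Ω] {w : ℝ → Ω → ℝ}
    (hw : ∀ t, Measurable (w t)) (t : ℝ) : natSigma w t ≤ mΩ :=
  iSup₂_le fun s _ => (hw s).comap_le

lemma natSigma_mono {Ω : Type*} [MeasurableSpace Ω] (w : ℝ → Ω → ℝ) {s t : ℝ} (hst : s ≤ t) :
    natSigma w s ≤ natSigma w t :=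
  biSup_mono fun _ h => ⟨h.1, h.2.trans hst⟩

section Path

variable {f : ℝ → ℝ} {c : ℝ → ℝ}

lemma intervalIntegrable_comp_path (hf : ContinuousOn f (Ici 0)) (hc : Continuous c) {r s : ℝ}
    (hr : 0 ≤ r) (hs : 0 ≤ s) : IntervalIntegrable (fun q => c (f q)) volume r s :=
  ((hc.comp_continuousOn hf).mono fun _ hq => (le_min hr hs).trans hq.1).intervalIntegrable

lemma abs_integral_comp_path_le {L : ℝ} (hL : ∀ y, |c y| ≤ L) {r s : ℝ} (hrs : r ≤ s) :
    |∫ q in r..s, c (f q)| ≤ L * (s - r) := by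
  have := intervalIntegral.norm_integral_le_of_norm_le_const (a := r) (b := s)
    (f := fun q => c (f q)) (C := L) fun q _ => hL _
  rwa [abs_of_nonneg (sub_nonneg.2 hrs)] at this

lemma hasDerivWithinAt_integral_comp_path (hf : ContinuousOn f (Ici 0)) (hc : Continuous c)
    {s : ℝ} (hs : 0 ≤ s) :
    HasDerivWithinAt (fun r => ∫ q in (0:ℝ)..r, c (f q)) (c (f s)) (Ici s) s := by
  have hcont : ContinuousOn (fun q => c (f q)) (Ioi s) :=
    (hc.comp_continuousOn hf).mono fun q hq => hs.trans (le_of_lt hq)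
  refine intervalIntegral.integral_hasDerivWithinAt_right (t := Ioi s)
    (intervalIntegrable_comp_path hf hc le_rfl hs) ?_ ?_
  · exact ⟨Ioi s, self_mem_nhdsWithin, hcont.aestronglyMeasurable measurableSet_Ioi⟩
  · exact ((hc.comp_continuousOn hf) s hs).mono fun q hq => hs.trans (le_of_lt hq)

lemma exp_integral_comp_path_le {L : ℝ} (hL : ∀ y, |c y| ≤ L) {s t : ℝ} (hs : 0 ≤ s)
    (hst : s ≤ t) : Real.exp (∫ q in (0:ℝ)..s, c (f q)) ≤ Real.exp (L * t) := by
  have hL0 : 0 ≤ L := (abs_nonneg _).trans (hL 0)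
  refine Real.exp_le_exp.2 ((le_abs_self _).trans ((abs_integral_comp_path_le hL hs).trans ?_))
  rw [sub_zero]
  exact mul_le_mul_of_nonneg_left hst hL0

variable {b W : ℝ → ℝ} {x : ℝ}

lemma path_sub_eq (hf : ContinuousOn f (Ici 0)) (hb : Continuous b)
    (hsde : ∀ t, 0 ≤ t → f t = x + (∫ s in (0:ℝ)..t, b (f s)) + W t) {r s : ℝ} (hs : 0 ≤ s)
    (hsr : s ≤ r) : f r - (f s + (W r - W s)) = ∫ q in s..r, b (f q) := by
  rw [hsde r (hs.trans hsr), hsde s hs, ← intervalIntegral.integral_interval_sub_left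
    (intervalIntegrable_comp_path hf hb le_rfl (hs.trans hsr))
    (intervalIntegrable_comp_path hf hb le_rfl hs)]
  ring

lemma abs_path_increment_le (hf : ContinuousOn f (Ici 0)) (hb : Continuous b)
    (hsde : ∀ t, 0 ≤ t → f t = x + (∫ s in (0:ℝ)..t, b (f s)) + W t) (hc : Continuous c)
    {u u' : ℝ → ℝ} (hu : ∀ y, HasDerivAt u (u' y) y) {K L B B' : ℝ} (hK : ∀ y, |b y| ≤ K)
    (hL : ∀ y, |c y| ≤ L) (hB : ∀ y, |u y| ≤ B) (hB' : ∀ y, |u' y| ≤ B') {s r t : ℝ}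
    (hs : 0 ≤ s) (hsr : s ≤ r) (hrt : r ≤ t) :
    |u (f r) * Real.exp (∫ q in (0:ℝ)..r, c (f q))
        - u (f s + (W r - W s)) * Real.exp (∫ q in (0:ℝ)..s, c (f q))|
      ≤ (B * (Real.exp (L * t) * L) + B' * K * Real.exp (L * t)) * (r - s) := by
  have hB0 : 0 ≤ B := (abs_nonneg _).trans (hB 0)
  have hB'0 : 0 ≤ B' := (abs_nonneg _).trans (hB' 0)
  have hr : 0 ≤ r := hs.trans hsr
  set E : ℝ → ℝ := fun r => Real.exp (∫ q in (0:ℝ)..r, c (f q)) with hE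
  have h1 : |E r - E s| ≤ Real.exp (L * t) * (L * (r - s)) := by
    have hmv := (convex_Iic (L * t)).norm_image_sub_le_of_norm_hasDerivWithin_le
      (C := Real.exp (L * t)) (fun y _ => (Real.hasDerivAt_exp y).hasDerivWithinAt)
      (fun y hy => by rw [Real.norm_eq_abs, Real.abs_exp]; exact Real.exp_le_exp.2 hy)
      (Real.exp_le_exp.1 (exp_integral_comp_path_le (f := f) hL hs (hsr.trans hrt)))
      (Real.exp_le_exp.1 (exp_integral_comp_path_le (f := f) hL hr hrt))
    refine hmv.trans (mul_le_mul_of_nonneg_left ?_ (Real.exp_nonneg _))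
    rw [intervalIntegral.integral_interval_sub_left
      (intervalIntegrable_comp_path hf hc le_rfl hr) (intervalIntegrable_comp_path hf hc le_rfl hs)]
    exact abs_integral_comp_path_le hL hsr
  have h2 : |u (f r) - u (f s + (W r - W s))| ≤ B' * (K * (r - s)) := by
    refine (convex_univ.norm_image_sub_le_of_norm_hasDerivWithin_le
      (fun y _ => (hu y).hasDerivWithinAt) (fun y _ => hB' y) (mem_univ _) (mem_univ _)).trans ?_
    rw [path_sub_eq hf hb hsde hs hsr]
    exact mul_le_mul_of_nonneg_left (abs_integral_comp_path_le hK hsr) hB'0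
  have hEs : |E s| ≤ Real.exp (L * t) := by
    rw [hE, Real.abs_exp]
    exact exp_integral_comp_path_le hL hs (hsr.trans hrt)
  calc |u (f r) * E r - u (f s + (W r - W s)) * E s|
      = |u (f r) * (E r - E s) + (u (f r) - u (f s + (W r - W s))) * E s| := by ring_nf
    _ ≤ |u (f r)| * |E r - E s| + |u (f r) - u (f s + (W r - W s))| * |E s| := by
      rw [← abs_mul, ← abs_mul]
      exact abs_add_le _ _
    _ ≤ B * (Real.exp (L * t) * (L * (r - s))) + B' * (K * (r - s)) * Real.exp (L * t) := by
      refine add_le_add (mul_le_mul (hB _) h1 (abs_nonneg _) hB0)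
        (mul_le_mul h2 hEs (abs_nonneg _) ((abs_nonneg _).trans h2))
    _ = _ := by ring

lemma tendsto_path_increment (hf : ContinuousOn f (Ici 0)) (hW : Continuous W) (hb : Continuous b)
    (hsde : ∀ t, 0 ≤ t → f t = x + (∫ s in (0:ℝ)..t, b (f s)) + W t) (hc : Continuous c)
    {u u' : ℝ → ℝ} (hu : ∀ y, HasDerivAt u (u' y) y) (hu' : Continuous u') {s : ℝ} (hs : 0 ≤ s) :
    Tendsto (fun r => (r - s)⁻¹ * (u (f r) * Real.exp (∫ q in (0:ℝ)..r, c (f q))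
        - u (f s + (W r - W s)) * Real.exp (∫ q in (0:ℝ)..s, c (f q))))
      (nhdsWithin s (Ioi s))
      (nhds ((b (f s) * u' (f s) + c (f s) * u (f s)) * Real.exp (∫ q in (0:ℝ)..s, c (f q)))) := by
  have hfs : Tendsto f (nhdsWithin s (Ioi s)) (nhds (f s)) :=
    (hf s hs).mono_left (nhdsWithin_mono _ fun q hq => hs.trans (le_of_lt hq))
  have hys : Tendsto (fun r => f s + (W r - W s)) (nhdsWithin s (Ioi s)) (nhds (f s)) := by
    have : Continuous fun r => f s + (W r - W s) := by fun_prop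
    simpa using (this.tendsto s).mono_left nhdsWithin_le_nhds
  have huc : Continuous u := continuous_iff_continuousAt.2 fun y => (hu y).continuousAt
  have slope : ∀ {F : ℝ → ℝ} {d : ℝ}, HasDerivWithinAt F d (Ici s) s →
      Tendsto (fun r => (r - s)⁻¹ * (F r - F s)) (nhdsWithin s (Ioi s)) (nhds d) := fun h =>
    (hasDerivWithinAt_iff_tendsto_slope' self_notMem_Ioi).1 h.Ioi_of_Ici
  have hexp := slope (hasDerivWithinAt_integral_comp_path hf hc hs).exp
  have hD := slope (hasDerivWithinAt_integral_comp_path hf hb hs)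
  have hsub : ∀ᶠ r in nhdsWithin s (Ioi s), f r - (f s + (W r - W s)) =
      (∫ q in (0:ℝ)..r, b (f q)) - ∫ q in (0:ℝ)..s, b (f q) := by
    filter_upwards [self_mem_nhdsWithin] with r hr
    have hr : s ≤ r := le_of_lt hr
    rw [path_sub_eq hf hb hsde hs hr, intervalIntegral.integral_interval_sub_left
      (intervalIntegrable_comp_path hf hb le_rfl (hs.trans hr))
      (intervalIntegrable_comp_path hf hb le_rfl hs)]
  have hD' : Tendsto (fun r => (r - s)⁻¹ * (f r - (f s + (W r - W s))))
      (nhdsWithin s (Ioi s)) (nhds (b (f s))) :=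
    hD.congr' (hsub.mono fun r hr => by simp only [hr])
  have hstrict : HasStrictDerivAt u (u' (f s)) (f s) :=
    hasStrictDerivAt_of_hasDerivAt_of_continuousAt (Eventually.of_forall hu) hu'.continuousAt
  have hlit := hstrict.hasStrictFDerivAt.isLittleO.comp_tendsto (hfs.prodMk_nhds hys)
  have hrem : Tendsto (fun r => (r - s)⁻¹ * (u (f r) - u (f s + (W r - W s))
      - (f r - (f s + (W r - W s))) * u' (f s))) (nhdsWithin s (Ioi s)) (nhds 0) := by
    have h1 := (Asymptotics.isBigO_refl (fun r => (r - s)⁻¹) (nhdsWithin s (Ioi s))).mul_isLittleO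
      hlit
    have h2 := h1.trans_isBigO (hD'.isBigO_one ℝ)
    simpa [Asymptotics.isLittleO_one_iff, Function.comp_def] using h2
  have hsum := ((huc.tendsto _).comp hfs).mul hexp |>.add
    ((hrem.add (hD'.mul_const (u' (f s)))).mul_const (Real.exp (∫ q in (0:ℝ)..s, c (f q))))
  refine (hsum.congr fun r => ?_).trans_eq ?_
  · simp only [Function.comp]
    ring
  · congr 1
    ring

end Path

section FeynmanKac

variable {Ω : Type*} [MeasureSpace Ω] {w : ℝ → Ω → ℝ} {b c : ℝ → ℝ} {x : ℝ} {φ : ℝ → Ω → ℝ}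

lemma IsStrongSolution.exists_measurable_eq_integral (hφ : IsStrongSolution b w x φ)
    (hc : Continuous c) {L : ℝ} (hL : ∀ y, |c y| ≤ L) {s : ℝ} (hs : 0 ≤ s) :
    ∃ H : Ω → ℝ, Measurable[natSigma w s] H ∧
      ∀ᵐ ω ∂(ℙ : Measure Ω), H ω = ∫ q in (0:ℝ)..s, c (φ q ω) := by
  obtain ⟨H, hH, hH'⟩ := exists_measurable_eq_intervalIntegral (m := natSigma w s)
    (X := fun r ω => c (φ r ω)) hs
    (fun r hr => hc.measurable.comp ((hφ.adapted r hr.1).mono (natSigma_mono w hr.2) le_rfl))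
    (fun r ω => hL _)
  exact ⟨H, hH, hφ.cont.mono fun ω hω => hH' ω (hc.comp_continuousOn hω)⟩

lemma IsStrongSolution.measurable (hw : IsWiener w) (hφ : IsStrongSolution b w x φ) {s : ℝ}
    (hs : 0 ≤ s) : Measurable (φ s) :=
  (hφ.adapted s hs).mono (natSigma_le hw.meas s) le_rfl

lemma IsStrongSolution.aemeasurable_exp (hw : IsWiener w) (hφ : IsStrongSolution b w x φ)
    (hc : Continuous c) {L : ℝ} (hL : ∀ y, |c y| ≤ L) {s : ℝ} (hs : 0 ≤ s) :
    AEMeasurable (fun ω => Real.exp (∫ q in (0:ℝ)..s, c (φ q ω))) (ℙ : Measure Ω) := by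
  obtain ⟨H, hH, hH'⟩ := hφ.exists_measurable_eq_integral hc hL hs
  exact ⟨fun ω => Real.exp (H ω), (hH.mono (natSigma_le hw.meas s) le_rfl).exp,
    hH'.mono fun ω hω => by simp only [hω]⟩

lemma IsStrongSolution.integrable_mul_exp (hw : IsWiener w) (hφ : IsStrongSolution b w x φ)
    (hc : Continuous c) {L : ℝ} (hL : ∀ y, |c y| ≤ L) {s : ℝ} (hs : 0 ≤ s) {X : Ω → ℝ}
    (hX : Measurable X) {B : ℝ} (hB : ∀ ω, |X ω| ≤ B) :
    Integrable (fun ω => X ω * Real.exp (∫ q in (0:ℝ)..s, c (φ q ω))) (ℙ : Measure Ω) := by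
  have := hw.isProb
  refine Integrable.of_bound
    (hX.aemeasurable.mul (hφ.aemeasurable_exp hw hc hL hs)).aestronglyMeasurable
    (B * Real.exp (L * s)) (ae_of_all _ fun ω => ?_)
  rw [Real.norm_eq_abs, abs_mul, Real.abs_exp]
  exact mul_le_mul (hB ω) (exp_integral_comp_path_le hL hs le_rfl) (Real.exp_nonneg _)
    ((abs_nonneg _).trans (hB ω))

variable {u u' u'' : ℝ → ℝ} {K L B B' C : ℝ}

lemma IsStrongSolution.continuousOn_integral_mul_exp (hw : IsWiener w)
    (hφ : IsStrongSolution b w x φ) (hc : Continuous c) (hL : ∀ y, |c y| ≤ L) (hu : Continuous u)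
    (hB : ∀ y, |u y| ≤ B) (t : ℝ) :
    ContinuousOn (fun r => ∫ ω, u (φ r ω) * Real.exp (∫ q in (0:ℝ)..r, c (φ q ω))
      ∂(ℙ : Measure Ω)) (Icc 0 t) := by
  have := hw.isProb
  refine continuousOn_of_dominated (bound := fun _ => B * Real.exp (L * t)) (fun r hr =>
    (hφ.integrable_mul_exp hw hc hL hr.1 (hu.measurable.comp (hφ.measurable hw hr.1))
      fun ω => hB _).aestronglyMeasurable) (fun r hr => ae_of_all _ fun ω => ?_)
    (integrable_const _) ?_
  · rw [Real.norm_eq_abs, abs_mul, Real.abs_exp]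
    exact mul_le_mul (hB _) (exp_integral_comp_path_le hL hr.1 hr.2) (Real.exp_nonneg _)
      ((abs_nonneg _).trans (hB 0))
  · filter_upwards [hφ.cont] with ω hω
    have hω' : ContinuousOn (fun r => φ r ω) (Icc 0 t) := hω.mono Icc_subset_Ici_self
    refine (hu.comp_continuousOn hω').mul (Real.continuous_exp.comp_continuousOn ?_)
    exact intervalIntegral.continuousOn_primitive_interval'
      (b₁ := 0) (b₂ := max 0 t) (intervalIntegrable_comp_path hω hc le_rfl (le_max_left _ _))
      left_mem_uIcc |>.mono fun r hr => by
        rw [uIcc_of_le (le_max_left _ _)]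
        exact ⟨hr.1, hr.2.trans (le_max_right _ _)⟩

/-- The contribution of the drift and of the potential to the generator. -/
lemma IsStrongSolution.tendsto_integral_drift_increment (hw : IsWiener w)
    (hφ : IsStrongSolution b w x φ) (hb : Continuous b) (hK : ∀ y, |b y| ≤ K)
    (hc : Continuous c) (hL : ∀ y, |c y| ≤ L) (hu : ∀ y, HasDerivAt u (u' y) y)
    (hu' : Continuous u') (hB : ∀ y, |u y| ≤ B) (hB' : ∀ y, |u' y| ≤ B') {s : ℝ} (hs : 0 ≤ s) :
    Tendsto (fun r => ∫ ω, (r - s)⁻¹ * (u (φ r ω) * Real.exp (∫ q in (0:ℝ)..r, c (φ q ω))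
        - u (φ s ω + (w r ω - w s ω)) * Real.exp (∫ q in (0:ℝ)..s, c (φ q ω))) ∂(ℙ : Measure Ω))
      (nhdsWithin s (Ioi s))
      (nhds (∫ ω, (b (φ s ω) * u' (φ s ω) + c (φ s ω) * u (φ s ω))
        * Real.exp (∫ q in (0:ℝ)..s, c (φ q ω)) ∂(ℙ : Measure Ω))) := by
  have := hw.isProb
  have huc : Continuous u := continuous_iff_continuousAt.2 fun y => (hu y).continuousAt
  refine tendsto_integral_filter_of_dominated_convergence (fun _ =>
    B * (Real.exp (L * (s + 1)) * L) + B' * K * Real.exp (L * (s + 1))) ?_ ?_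
    (integrable_const _) ?_
  · filter_upwards [self_mem_nhdsWithin] with r hr
    have hr : 0 ≤ r := hs.trans (le_of_lt hr)
    have hφs := hφ.measurable hw hs
    have hws := hw.meas s
    have hwr := hw.meas r
    exact (((hφ.integrable_mul_exp hw hc hL hr (huc.measurable.comp (hφ.measurable hw hr))
      fun ω => hB _).sub (hφ.integrable_mul_exp hw hc hL hs
        (X := fun ω => u (φ s ω + (w r ω - w s ω))) (by fun_prop)
        fun ω => hB _)).const_mul _).aestronglyMeasurable
  · filter_upwards [Ioo_mem_nhdsGT (lt_add_one s)] with r hr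
    filter_upwards [hφ.cont, hφ.sde] with ω hω hsde
    rw [Real.norm_eq_abs, abs_mul, abs_of_pos (inv_pos.2 (sub_pos.2 hr.1)),
      inv_mul_le_iff₀ (sub_pos.2 hr.1), mul_comm (r - s)]
    exact abs_path_increment_le (f := fun r => φ r ω) (W := fun r => w r ω) hω hb hsde hc hu hK hL
      hB hB' hs hr.1.le hr.2.le
  · filter_upwards [hφ.cont, hφ.sde, hw.cont] with ω hω hsde hW
    exact tendsto_path_increment (f := fun r => φ r ω) (W := fun r => w r ω) hω hW hb hsde hc hu
      hu' hs

/-- The contribution of the Gaussian increment is that of the heat semigroup. -/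
lemma IsStrongSolution.integral_gaussian_increment (hw : IsWiener w)
    (hφ : IsStrongSolution b w x φ) (hc : Continuous c) (hL : ∀ y, |c y| ≤ L) (hu : Continuous u)
    (hB : ∀ y, |u y| ≤ B) {s r : ℝ} (hs : 0 ≤ s) (hsr : s ≤ r) :
    ∫ ω, (u (φ s ω + (w r ω - w s ω)) - u (φ s ω)) * Real.exp (∫ q in (0:ℝ)..s, c (φ q ω))
        ∂(ℙ : Measure Ω) =
      ∫ ω, (∫ z, (u (φ s ω + z) - u (φ s ω)) ∂(gaussianReal 0 (r - s).toNNReal))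
        * Real.exp (∫ q in (0:ℝ)..s, c (φ q ω)) ∂(ℙ : Measure Ω) := by
  have := hw.isProb
  obtain ⟨H, hH, hH'⟩ := hφ.exists_measurable_eq_integral hc hL hs
  have hXm : Measurable[natSigma w s] fun ω => (H ω, φ s ω) := hH.prodMk (hφ.adapted s hs)
  have hind : IndepFun (fun ω => (H ω, φ s ω)) (fun ω => w r ω - w s ω) (ℙ : Measure Ω) :=
    indep_of_indep_of_le_left (hw.indep s r hs hsr).symm hXm.comap_le
  have hHL : ∀ᵐ ω ∂(ℙ : Measure Ω), min (H ω) (L * s) = ∫ q in (0:ℝ)..s, c (φ q ω) := by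
    filter_upwards [hH'] with ω hω
    rw [← hω, min_eq_left]
    rw [hω]
    exact Real.exp_le_exp.1 (exp_integral_comp_path_le hL hs le_rfl)
  have key := integral_prod_of_indepFun (hXm.mono (natSigma_le hw.meas s) le_rfl)
    (Y := fun ω => w r ω - w s ω) ((hw.meas r).sub (hw.meas s)) hind
    (F := fun q : (ℝ × ℝ) × ℝ => (u (q.1.2 + q.2) - u q.1.2) * Real.exp (min q.1.1 (L * s)))
    (by fun_prop) (B := (B + B) * Real.exp (L * s)) fun q => by
      rw [abs_mul, Real.abs_exp]
      refine mul_le_mul ((abs_sub _ _).trans (add_le_add (hB _) (hB _)))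
        (Real.exp_le_exp.2 (min_le_right _ _)) (Real.exp_nonneg _) ?_
      linarith [(abs_nonneg _).trans (hB 0)]
  rw [hw.gauss s r hs hsr] at key
  calc _ = _ := integral_congr_ae (hHL.mono fun ω hω => by simp only [hω])
    _ = _ := key
    _ = _ := integral_congr_ae (hHL.mono fun ω hω => by
      simp only [hω]
      exact integral_mul_const _ _)

lemma IsStrongSolution.tendsto_integral_gaussian_increment (hw : IsWiener w)
    (hφ : IsStrongSolution b w x φ) (hc : Continuous c) (hL : ∀ y, |c y| ≤ L)
    (hu : ∀ y, HasDerivAt u (u' y) y) (hu' : ∀ y, HasDerivAt u' (u'' y) y)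
    (hB : ∀ y, |u y| ≤ B) (hC : ∀ y, |u'' y| ≤ C) {s : ℝ} (hs : 0 ≤ s) :
    Tendsto (fun r => (r - s)⁻¹ * ∫ ω, (u (φ s ω + (w r ω - w s ω)) - u (φ s ω))
        * Real.exp (∫ q in (0:ℝ)..s, c (φ q ω)) ∂(ℙ : Measure Ω))
      (nhdsWithin s (Ioi s))
      (nhds (∫ ω, u'' (φ s ω) / 2 * Real.exp (∫ q in (0:ℝ)..s, c (φ q ω)) ∂(ℙ : Measure Ω))) := by
  have := hw.isProb
  have huc : Continuous u := continuous_iff_continuousAt.2 fun y => (hu y).continuousAt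
  have hφs := hφ.measurable hw hs
  have hshift : Tendsto (fun r => r - s) (nhdsWithin s (Ioi s)) (nhdsWithin 0 (Ioi 0)) := by
    refine tendsto_nhdsWithin_iff.2 ⟨?_, ?_⟩
    · have : Continuous fun r => r - s := by fun_prop
      simpa using (this.tendsto s).mono_left nhdsWithin_le_nhds
    · filter_upwards [self_mem_nhdsWithin] with r hr
      exact sub_pos.2 (mem_Ioi.1 hr)
  have h : Tendsto (fun r => ∫ ω, (r - s)⁻¹ *
        (∫ z, (u (φ s ω + z) - u (φ s ω)) ∂(gaussianReal 0 (r - s).toNNReal))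
        * Real.exp (∫ q in (0:ℝ)..s, c (φ q ω)) ∂(ℙ : Measure Ω)) (nhdsWithin s (Ioi s))
      (nhds (∫ ω, u'' (φ s ω) / 2 * Real.exp (∫ q in (0:ℝ)..s, c (φ q ω)) ∂(ℙ : Measure Ω))) := by
    refine tendsto_integral_filter_of_dominated_convergence (fun _ => C * Real.exp (L * s))
      (Eventually.of_forall fun r => ?_) ?_ (integrable_const _) (ae_of_all _ fun ω =>
        ((tendsto_integral_gaussianReal_increment hu hu' hB hC _).comp hshift).mul_const _)
    · have hm : Measurable fun y =>
          ∫ z, (u (y + z) - u y) ∂(gaussianReal 0 (r - s).toNNReal) := by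
        have hF : Measurable fun q : ℝ × ℝ => u (q.1 + q.2) - u q.1 := by fun_prop
        exact hF.stronglyMeasurable.integral_prod_right'.measurable
      exact (((hm.comp hφs).const_mul _).aemeasurable.mul
        (hφ.aemeasurable_exp hw hc hL hs)).aestronglyMeasurable
    · filter_upwards [self_mem_nhdsWithin] with r hr
      have hr : 0 < r - s := sub_pos.2 hr
      refine ae_of_all _ fun ω => ?_
      rw [Real.norm_eq_abs, abs_mul, Real.abs_exp]
      refine mul_le_mul ?_ (exp_integral_comp_path_le hL hs le_rfl) (Real.exp_nonneg _)
        ((abs_nonneg _).trans (hC 0))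
      rw [abs_mul, abs_of_pos (inv_pos.2 hr), inv_mul_le_iff₀ hr, mul_comm (r - s)]
      exact abs_integral_gaussianReal_increment_le hu hu' hB hC _ hr.le
  refine h.congr' ?_
  filter_upwards [self_mem_nhdsWithin] with r hr
  rw [hφ.integral_gaussian_increment hw hc hL huc hB hs (le_of_lt hr), ← integral_const_mul]
  simp only [mul_assoc]

/-- A Feynman–Kac bound: if `u` is a `C²` function with bounded derivatives and
`u'' / 2 + b u' + c u ≤ lam u`, then `E[u(φ_t) exp(∫_0^t c(φ_s) ds)] ≤ e^{lam t} u(x)`. -/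
theorem IsStrongSolution.integral_mul_exp_le (hw : IsWiener w) (hφ : IsStrongSolution b w x φ)
    (hb : Continuous b) (hK : ∀ y, |b y| ≤ K) (hc : Continuous c) (hL : ∀ y, |c y| ≤ L)
    (hu : ∀ y, HasDerivAt u (u' y) y) (hu' : ∀ y, HasDerivAt u' (u'' y) y)
    (hu'' : Continuous u'') (hB : ∀ y, |u y| ≤ B) (hB' : ∀ y, |u' y| ≤ B')
    (hC : ∀ y, |u'' y| ≤ C) {lam : ℝ}
    (hlam : ∀ y, u'' y / 2 + b y * u' y + c y * u y ≤ lam * u y) {t : ℝ} (ht : 0 ≤ t) :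
    ∫ ω, u (φ t ω) * Real.exp (∫ q in (0:ℝ)..t, c (φ q ω)) ∂(ℙ : Measure Ω)
      ≤ u x * Real.exp (lam * t) := by
  have := hw.isProb
  have huc : Continuous u := continuous_iff_continuousAt.2 fun y => (hu y).continuousAt
  have hu'c : Continuous u' := continuous_iff_continuousAt.2 fun y => (hu' y).continuousAt
  let gen : ℝ → ℝ := fun y => u'' y / 2 + (b y * u' y + c y * u y)
  have hint₁ : ∀ s, 0 ≤ s → Integrable (fun ω => u'' (φ s ω) / 2 *
      Real.exp (∫ q in (0:ℝ)..s, c (φ q ω))) (ℙ : Measure Ω) := fun s hs => by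
    have hφs := hφ.measurable hw hs
    refine hφ.integrable_mul_exp hw hc hL hs (by fun_prop) (B := C / 2) fun ω => ?_
    rw [abs_div, abs_two]
    linarith [hC (φ s ω)]
  have hint₂ : ∀ s, 0 ≤ s → Integrable (fun ω => (b (φ s ω) * u' (φ s ω) + c (φ s ω) * u (φ s ω)) *
      Real.exp (∫ q in (0:ℝ)..s, c (φ q ω))) (ℙ : Measure Ω) := fun s hs => by
    have hφs := hφ.measurable hw hs
    refine hφ.integrable_mul_exp hw hc hL hs (by fun_prop) (B := K * B' + L * B) fun ω => ?_
    refine (abs_add_le _ _).trans ?_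
    rw [abs_mul, abs_mul]
    exact add_le_add
      (mul_le_mul (hK _) (hB' _) (abs_nonneg _) ((abs_nonneg _).trans (hK 0)))
      (mul_le_mul (hL _) (hB _) (abs_nonneg _) ((abs_nonneg _).trans (hL 0)))
  have hint : ∀ s, 0 ≤ s → Integrable (fun ω => u (φ s ω) *
      Real.exp (∫ q in (0:ℝ)..s, c (φ q ω))) (ℙ : Measure Ω) := fun s hs =>
    hφ.integrable_mul_exp hw hc hL hs (huc.measurable.comp (hφ.measurable hw hs)) fun ω => hB _
  have hderiv : ∀ s, 0 ≤ s → Tendsto (fun r => (r - s)⁻¹ *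
      ((∫ ω, u (φ r ω) * Real.exp (∫ q in (0:ℝ)..r, c (φ q ω)) ∂(ℙ : Measure Ω))
        - ∫ ω, u (φ s ω) * Real.exp (∫ q in (0:ℝ)..s, c (φ q ω)) ∂(ℙ : Measure Ω)))
      (nhdsWithin s (Ioi s)) (nhds (∫ ω, gen (φ s ω) *
        Real.exp (∫ q in (0:ℝ)..s, c (φ q ω)) ∂(ℙ : Measure Ω))) := fun s hs => by
    have h := (hφ.tendsto_integral_gaussian_increment hw hc hL hu hu' hB hC hs).add
      (hφ.tendsto_integral_drift_increment hw hb hK hc hL hu hu'c hB hB' hs)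
    rw [← integral_add (hint₁ s hs) (hint₂ s hs)] at h
    simp only [← add_mul] at h
    refine h.congr' ?_
    filter_upwards [self_mem_nhdsWithin] with r hr
    have hr : 0 ≤ r := hs.trans (le_of_lt hr)
    have hi : Integrable (fun ω => u (φ s ω + (w r ω - w s ω)) *
        Real.exp (∫ q in (0:ℝ)..s, c (φ q ω))) (ℙ : Measure Ω) := by
      have hφs := hφ.measurable hw hs
      have hws := hw.meas s
      have hwr := hw.meas r
      exact hφ.integrable_mul_exp hw hc hL hs (by fun_prop) fun ω => hB _
    simp only [sub_mul]
    rw [integral_const_mul, integral_sub (hint r hr) hi, integral_sub hi (hint s hs)]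
    ring
  have hgron := le_gronwallBound_of_liminf_deriv_right_le (K := lam) (ε := 0)
    (hφ.continuousOn_integral_mul_exp hw hc hL huc hB t)
    (fun s hs r hr => ((hderiv s hs.1).eventually (gt_mem_nhds hr)).frequently) le_rfl
    (fun s hs => by
      rw [add_zero, ← integral_const_mul]
      have hgi : Integrable (fun ω => gen (φ s ω) *
          Real.exp (∫ q in (0:ℝ)..s, c (φ q ω))) (ℙ : Measure Ω) := by
        refine ((hint₁ s hs.1).add (hint₂ s hs.1)).congr (ae_of_all _ fun ω => ?_)
        simp only [Pi.add_apply, gen, add_mul]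
      refine integral_mono hgi ((hint s hs.1).const_mul lam) fun ω => ?_
      simp only [← mul_assoc]
      refine mul_le_mul_of_nonneg_right ?_ (Real.exp_nonneg _)
      simpa only [gen, add_assoc] using hlam (φ s ω)) t ⟨ht, le_rfl⟩
  simpa [gronwallBound_ε0, hφ.init] using hgron

end FeynmanKac

/-- Exponential moments of `∫_0^t b'(φ_s) ds`, controlled by the sup norm and the support of the
drift only: apply the Feynman–Kac bound to `u = exp(-2p ∫_0^y b)`, whose second derivative
cancels the potential `p b'`. -/
theorem IsStrongSolution.integral_exp_deriv_rpow_le {Ω : Type*} [MeasureSpace Ω]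
    {w : ℝ → Ω → ℝ} (hw : IsWiener w) {b : ℝ → ℝ} (hb : ContDiff ℝ 1 b) {K R : ℝ}
    (hK : ∀ y, |b y| ≤ K) (hR0 : 0 ≤ R) (hR : ∀ y, R < |y| → b y = 0) {x : ℝ} {φ : ℝ → Ω → ℝ}
    (hφ : IsStrongSolution b w x φ) {p : ℝ} (hp : 0 ≤ p) {t : ℝ} (ht : 0 ≤ t) :
    ∫ ω, Real.exp (∫ s in (0:ℝ)..t, deriv b (φ s ω)) ^ p ∂(ℙ : Measure Ω)
      ≤ Real.exp (4 * p * (R * K)) * (Real.exp (4 * p * (R * K)) *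
        Real.exp (2 * p ^ 2 * K ^ 2 * t)) := by
  have := hw.isProb
  have hbc : Continuous b := hb.continuous
  have hdc : Continuous (deriv b) := hb.continuous_deriv le_rfl
  have hK0 : 0 ≤ K := (abs_nonneg _).trans (hK 0)
  have hsupp : HasCompactSupport b := by
    refine HasCompactSupport.intro (isCompact_Icc (a := -R) (b := R)) fun y hy => ?_
    exact hR y (lt_of_not_ge fun h => hy (abs_le.1 h))
  obtain ⟨L, hL⟩ := hdc.bounded_above_of_compact_support hsupp.deriv
  have hI : ∀ y, |∫ r in (0:ℝ)..y, b r| ≤ 2 * (R * K) := fun y => by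
    have hind : ∀ r, ‖b r‖ ≤ (Icc (-R) R).indicator (fun _ => K) r := fun r => by
      by_cases hr : r ∈ Icc (-R) R
      · rw [indicator_of_mem hr]
        exact hK r
      · rw [indicator_of_notMem hr, hR r (lt_of_not_ge fun h => hr (abs_le.1 h)), norm_zero]
    have hindi : Integrable ((Icc (-R) R).indicator fun _ => K) :=
      (integrable_indicator_iff measurableSet_Icc).2 (by simp)
    calc |∫ r in (0:ℝ)..y, b r| ≤ ∫ r in uIoc 0 y, ‖b r‖ :=
          intervalIntegral.norm_integral_le_integral_norm_uIoc (f := b)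
      _ ≤ ∫ r, ‖b r‖ := setIntegral_le_integral (hbc.integrable_of_hasCompactSupport hsupp).norm
          (ae_of_all _ fun r => norm_nonneg _)
      _ ≤ ∫ r, (Icc (-R) R).indicator (fun _ => K) r :=
          integral_mono (hbc.integrable_of_hasCompactSupport hsupp).norm hindi hind
      _ = 2 * (R * K) := by
          rw [integral_indicator measurableSet_Icc, setIntegral_const]
          simp [measureReal_def, Real.volume_Icc, ENNReal.toReal_ofReal (by linarith : 0 ≤ R + R)]
          ring
  set u : ℝ → ℝ := fun y => Real.exp (-2 * p * ∫ r in (0:ℝ)..y, b r) with hu_def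
  have hu : ∀ y, HasDerivAt u (-2 * p * b y * u y) y := fun y =>
    ((hbc.integral_hasStrictDerivAt 0 y).hasDerivAt.const_mul (-2 * p)).exp.congr_deriv (by ring)
  have hu' : ∀ y, HasDerivAt (fun y => -2 * p * b y * u y)
      ((-2 * p * deriv b y + 4 * p ^ 2 * b y ^ 2) * u y) y := fun y =>
    ((((hb.differentiable one_ne_zero) y).hasDerivAt.const_mul (-2 * p)).mul (hu y)).congr_deriv
      (by ring)
  have huc : Continuous u := continuous_iff_continuousAt.2 fun y => (hu y).continuousAt
  have hexp : ∀ y, |-2 * p * ∫ r in (0:ℝ)..y, b r| ≤ 4 * p * (R * K) := fun y => by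
    rw [abs_mul, abs_mul, abs_of_nonneg hp, abs_neg, abs_two]
    nlinarith [hI y]
  have hB : ∀ y, |u y| ≤ Real.exp (4 * p * (R * K)) := fun y => by
    rw [hu_def, Real.abs_exp]
    exact Real.exp_le_exp.2 ((le_abs_self _).trans (hexp y))
  have hlow : ∀ y, 1 ≤ Real.exp (4 * p * (R * K)) * u y := fun y => by
    rw [hu_def, ← Real.exp_add]
    exact Real.one_le_exp (by linarith [neg_le_of_abs_le (hexp y)])
  have hu_pos : ∀ y, 0 < u y := fun y => Real.exp_pos _
  have hbsq : ∀ y, b y ^ 2 ≤ K ^ 2 := fun y => sq_le_sq' (abs_le.1 (hK y)).1 (abs_le.1 (hK y)).2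
  have hcL : ∀ y, |p * deriv b y| ≤ p * L := fun y => by
    rw [abs_mul, abs_of_nonneg hp]
    exact mul_le_mul_of_nonneg_left (hL y) hp
  have key := hφ.integral_mul_exp_le hw hbc hK (c := fun y => p * deriv b y) (by fun_prop) hcL
    hu hu' (by fun_prop) hB (B' := 2 * p * K * Real.exp (4 * p * (R * K))) (fun y => by
      rw [abs_mul, abs_mul, abs_mul, abs_of_nonneg hp, abs_neg, abs_two]
      exact mul_le_mul (mul_le_mul_of_nonneg_left (hK y) (by positivity)) (hB y) (abs_nonneg _)
        (by positivity))
    (C := (2 * p * L + 4 * p ^ 2 * K ^ 2) * Real.exp (4 * p * (R * K))) (fun y => by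
      have h1 : |-2 * p * deriv b y + 4 * p ^ 2 * b y ^ 2| ≤ 2 * p * L + 4 * p ^ 2 * K ^ 2 := by
        have h2 := abs_le.1 (hcL y)
        have h3 := mul_le_mul_of_nonneg_left (hbsq y) (by positivity : 0 ≤ 4 * p ^ 2)
        have h4 : 0 ≤ 4 * p ^ 2 * b y ^ 2 := by positivity
        rw [abs_le]
        constructor <;> linarith
      rw [abs_mul]
      exact mul_le_mul h1 (hB y) (abs_nonneg _) ((abs_nonneg _).trans h1))
    (lam := 2 * p ^ 2 * K ^ 2) (fun y => by
      have h1 : 2 * p ^ 2 * b y ^ 2 - 2 * p * b y ^ 2 ≤ 2 * p ^ 2 * K ^ 2 := by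
        have h3 := mul_le_mul_of_nonneg_left (hbsq y) (by positivity : 0 ≤ 2 * p ^ 2)
        have h4 : 0 ≤ 2 * p * b y ^ 2 := by positivity
        linarith
      have h2 := mul_le_mul_of_nonneg_right h1 (hu_pos y).le
      linarith) ht
  have hmono : ∫ ω, Real.exp (∫ s in (0:ℝ)..t, deriv b (φ s ω)) ^ p ∂(ℙ : Measure Ω) ≤
      ∫ ω, Real.exp (4 * p * (R * K)) * (u (φ t ω) *
        Real.exp (∫ s in (0:ℝ)..t, p * deriv b (φ s ω))) ∂(ℙ : Measure Ω) := by
    refine integral_mono_of_nonneg (ae_of_all _ fun ω => by positivity)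
      ((hφ.integrable_mul_exp hw (by fun_prop) hcL ht
        (huc.measurable.comp (hφ.measurable hw ht)) fun ω => hB _).const_mul _)
      (ae_of_all _ fun ω => ?_)
    simp only
    rw [← Real.exp_mul, intervalIntegral.integral_const_mul, mul_comm p, ← mul_assoc]
    exact le_mul_of_one_le_left (Real.exp_nonneg _) (hlow _)
  refine hmono.trans ?_
  rw [integral_const_mul]
  refine mul_le_mul_of_nonneg_left (key.trans ?_) (Real.exp_nonneg _)
  exact mul_le_mul_of_nonneg_right ((le_abs_self _).trans (hB x)) (Real.exp_nonneg _)

lemma CondC.exists_abs_le {α : ℝ → ℝ} (hα : CondC α) : ∃ K, ∀ y, |α y| ≤ K := by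
  refine ⟨(eVariationOn α univ).toReal + |α 0|, fun y => ?_⟩
  have h := hα.dist_le (mem_univ y) (mem_univ 0)
  rw [Real.dist_eq] at h
  linarith [abs_sub_abs_le_abs_sub (α y) (α 0)]

lemma CondC.measurable {α : ℝ → ℝ} (hα : CondC α) : Measurable α := by
  obtain ⟨f, h, hf, hh, rfl⟩ :=
    (BoundedVariationOn.locallyBoundedVariationOn hα).exists_monotoneOn_sub_monotoneOn
  exact (monotoneOn_univ.1 hf).measurable.sub (monotoneOn_univ.1 hh).measurable

section Mollify

variable {g : ℕ → ℝ → ℝ} {α : ℝ → ℝ} {n : ℕ}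

lemma IsMollifier.hasCompactSupport (hg : IsMollifier g) (hn : 1 ≤ n) :
    HasCompactSupport (g n) :=
  HasCompactSupport.intro isCompact_Icc fun x hx =>
    (hg n hn).2.2.1 x fun h => hx (Ioo_subset_Icc_self h)

lemma IsMollifier.contDiff_mollify (hg : IsMollifier g) (hn : 1 ≤ n)
    (hα : LocallyIntegrable α) : ContDiff ℝ 1 (mollify g α n) := by
  have h := (hg.hasCompactSupport hn).contDiff_convolution_right (n := 1)
    (ContinuousLinearMap.mul ℝ ℝ) hα (hg n hn).1
  have heq : mollify g α n = convolution α (g n) (ContinuousLinearMap.mul ℝ ℝ) volume := by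
    ext x
    simp [mollify, convolution_def, mul_comm]
  rw [heq]
  exact_mod_cast h

lemma IsMollifier.abs_mollify_le (hg : IsMollifier g) (hn : 1 ≤ n) {K : ℝ}
    (hK : ∀ y, |α y| ≤ K) (x : ℝ) : |mollify g α n x| ≤ K := by
  have hi : Integrable (g n) :=
    (hg n hn).1.continuous.integrable_of_hasCompactSupport (hg.hasCompactSupport hn)
  have h := norm_integral_le_of_norm_le (f := fun y => g n (x - y) * α y)
    (g := fun y => g n (x - y) * K) ((hi.comp_sub_left x).mul_const K) (ae_of_all _ fun y => by
      rw [norm_mul, Real.norm_of_nonneg ((hg n hn).2.1 _)]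
      exact mul_le_mul_of_nonneg_left (hK y) ((hg n hn).2.1 _))
  rwa [integral_mul_const, integral_sub_left_eq_self (g n), (hg n hn).2.2.2, one_mul] at h

lemma IsMollifier.mollify_eq_zero (hg : IsMollifier g) (hn : 1 ≤ n) {R : ℝ}
    (hR : ∀ y, R < |y| → α y = 0) {x : ℝ} (hx : R + 1 < |x|) : mollify g α n x = 0 := by
  refine integral_eq_zero_of_ae (ae_of_all _ fun y => ?_)
  by_cases hy : R < |y|
  · simp [hR y hy]
  · have hxy : g n (x - y) = 0 := by
      refine (hg n hn).2.2.1 _ fun h => ?_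
      have h1 : |x - y| < 1 / n := abs_lt.2 h
      have h2 : (1 : ℝ) / n ≤ 1 := div_le_one_of_le₀ (by exact_mod_cast hn) (Nat.cast_nonneg n)
      linarith [abs_sub_abs_le_abs_sub x y]
    simp [hxy]

end Mollify

/-- Let `α` have bounded variation on `ℝ` and compact support, let `φⁿ`
solve the SDE with the mollified drift `αₙ`, and let
`ψ_tⁿ(x) = exp{∫_0^t αₙ'(φ_sⁿ(x)) ds}` be the spatial derivative of the flow `φⁿ`. Then
for every `p ≥ 1` and `t ≥ 0`, `sup_{n ≥ 1, x ∈ ℝ} E|ψ_tⁿ(x)|^p < ∞`. -/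
theorem derivative_moment_bound
    {Ω : Type*} [MeasureSpace Ω] (w : ℝ → Ω → ℝ) (hw : IsWiener w)
    (α : ℝ → ℝ) (hC : CondC α) (hsupp : HasCompactSupport α)
    (g : ℕ → ℝ → ℝ) (hg : IsMollifier g)
    (φn : ℕ → ℝ → ℝ → Ω → ℝ)
    (hφn : ∀ n : ℕ, 1 ≤ n → ∀ x : ℝ, IsStrongSolution (mollify g α n) w x (fun s => φn n s x))
    (p : ℝ) (hp : 1 ≤ p) (t : ℝ) (ht : 0 ≤ t) :
    ∃ M : ℝ, ∀ n : ℕ, 1 ≤ n → ∀ x : ℝ,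
      (∫ ω, (Real.exp (∫ s in (0:ℝ)..t, deriv (mollify g α n) (φn n s x ω))) ^ p
        ∂(ℙ : Measure Ω)) ≤ M := by
  obtain ⟨K, hK⟩ := hC.exists_abs_le
  obtain ⟨R, hR⟩ : ∃ R, ∀ y, R < |y| → α y = 0 := by
    obtain ⟨R, hR⟩ := hsupp.isBounded.exists_norm_le
    exact ⟨R, fun y hy => image_eq_zero_of_notMem_tsupport fun h => (hR y h).not_gt hy⟩
  have hR' : ∀ y, max R 0 < |y| → α y = 0 := fun y hy => hR y ((le_max_left _ _).trans_lt hy)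
  have hloc : LocallyIntegrable α := (locallyIntegrable_const K).mono
    hC.measurable.aestronglyMeasurable (ae_of_all _ fun y => (hK y).trans (le_abs_self K))
  exact ⟨_, fun n hn x => (hφn n hn x).integral_exp_deriv_rpow_le hw (hg.contDiff_mollify hn hloc)
    (hg.abs_mollify_le hn hK) (by positivity : 0 ≤ max R 0 + 1)
    (fun y hy => hg.mollify_eq_zero hn hR' hy) (zero_le_one.trans hp) ht⟩

end
end

section
/- Let α : ℝ → ℝ be a bounded function of bounded variation on ℝ with α(x) → a as x → +∞ and α(x) → b as x → −∞ for some a < 0 < b. Define the scale function s(x) = ∫_0^x exp{−2∫_0^z α(y)dy} dz, let q = s⁻¹ be its inverse, and set σ(y) = s'(q(y)) = exp{−2∫_0^{q(y)} α(z)dz}. Then σ is globally Lipschitz continuous on ℝ with |σ(x₂) − σ(x₁)| ≤ 2‖α‖_∞ |x₂ − x₁| for all x₁, x₂ ∈ ℝ, and its derivative satisfies σ'(y) = −2α(q(y)) for almost all y ∈ ℝ. -/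
open MeasureTheory Filter Set

noncomputable section

/-- A real function of locally bounded variation has at most countably many discontinuities. -/
theorem LocallyBoundedVariationOn.countable_not_continuousAt {f : ℝ → ℝ}
    (hf : LocallyBoundedVariationOn f Set.univ) :
    {x | ¬ContinuousAt f x}.Countable := by
  obtain ⟨p, r, hp, hr, rfl⟩ := hf.exists_monotoneOn_sub_monotoneOn
  rw [monotoneOn_univ] at hp hr
  refine (hp.countable_not_continuousAt.union hr.countable_not_continuousAt).mono fun x hx => ?_
  by_contra h
  simp only [Set.mem_union, Set.mem_ofPred_eq, not_or, not_not] at h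
  exact hx (h.1.sub h.2)

/-- A bounded measurable real function is interval integrable. -/
theorem Measurable.intervalIntegrable_of_abs_le {f : ℝ → ℝ} (hf : Measurable f) {M : ℝ}
    (hM : ∀ x, |f x| ≤ M) (c d : ℝ) : IntervalIntegrable f volume c d :=
  (intervalIntegrable_const (c := M)).mono_fun' hf.aestronglyMeasurable
    (Eventually.of_forall hM)

/-- Let `α : ℝ → ℝ` be bounded, of bounded variation on `ℝ`, with
`α(x) → a < 0` as `x → +∞` and `α(x) → b > 0` as `x → -∞`. Let
`s(x) = ∫_0^x exp{-2∫_0^z α(y)dy} dz` be the scale function, `q = s⁻¹` its inverse, and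
`σ(y) = s'(q(y)) = exp{-2∫_0^{q(y)} α(z)dz}`. Then `σ` is globally Lipschitz with
`|σ(x₂) - σ(x₁)| ≤ 2‖α‖_∞ |x₂ - x₁|`, and `σ'(y) = -2 α(q(y))` for almost every `y`. -/
theorem scale_diffusion_coefficient_lipschitz
    (α : ℝ → ℝ) (hBV : BoundedVariationOn α Set.univ)
    (hbdd : ∃ M : ℝ, ∀ x, |α x| ≤ M)
    (a b : ℝ) (ha : a < 0) (hb : 0 < b)
    (hlima : Filter.Tendsto α Filter.atTop (nhds a))
    (hlimb : Filter.Tendsto α Filter.atBot (nhds b))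
    (S : ℝ → ℝ) (hS : ∀ x : ℝ, S x = ∫ z in (0:ℝ)..x, Real.exp (-2 * ∫ y in (0:ℝ)..z, α y))
    (q : ℝ → ℝ) (hq₁ : ∀ y : ℝ, S (q y) = y) (hq₂ : ∀ x : ℝ, q (S x) = x)
    (σ : ℝ → ℝ) (hσ : ∀ y : ℝ, σ y = Real.exp (-2 * ∫ z in (0:ℝ)..(q y), α z)) :
    (∀ x₁ x₂ : ℝ, |σ x₂ - σ x₁| ≤ 2 * (⨆ x : ℝ, |α x|) * |x₂ - x₁|) ∧
    ∀ᵐ y : ℝ, HasDerivAt σ (-2 * α (q y)) y := by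
  obtain ⟨M, hM⟩ := hbdd
  have hDc := hBV.locallyBoundedVariationOn.countable_not_continuousAt
  have hαm : Measurable α := measurable_of_countable_not_continuousAt hDc
  have hαi := hαm.intervalIntegrable_of_abs_le hM
  set g : ℝ → ℝ := fun z => Real.exp (-2 * ∫ y in (0:ℝ)..z, α y) with hg
  have hgc : Continuous g :=
    (continuous_const.mul (intervalIntegral.continuous_primitive hαi 0)).rexp
  have hSd : ∀ x, HasDerivAt S (g x) x := fun x => by
    rw [funext hS]
    exact intervalIntegral.integral_hasDerivAt_right (hgc.intervalIntegrable 0 x)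
      (hgc.stronglyMeasurableAtFilter _ _) hgc.continuousAt
  have hSmono : StrictMono S := strictMono_of_hasDerivAt_pos hSd fun x => Real.exp_pos _
  have hqmono : Monotone q := fun y z hyz => hSmono.le_iff_le.1 (by rwa [hq₁, hq₁])
  have hqc : Continuous q := hqmono.continuous_of_surjective fun x => ⟨S x, hq₂ x⟩
  have hqd : ∀ y, HasDerivAt q (g (q y))⁻¹ y := fun y =>
    HasDerivAt.of_local_left_inverse hqc.continuousAt (hSd (q y)) (Real.exp_pos _).ne'
      (Eventually.of_forall hq₁)
  have hσg : σ = g ∘ q := funext hσ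
  have hσd : ∀ y, ContinuousAt α (q y) → HasDerivAt σ (-2 * α (q y)) y := fun y hy => by
    have hgd : HasDerivAt g (g (q y) * (-2 * α (q y))) (q y) :=
      ((intervalIntegral.integral_hasDerivAt_right (hαi 0 (q y))
        hαm.stronglyMeasurable.stronglyMeasurableAtFilter hy).const_mul (-2)).exp
    rw [hσg]
    refine (hgd.comp y (hqd y)).congr_deriv ?_
    rw [mul_right_comm, mul_inv_cancel₀ (Real.exp_pos _).ne', one_mul]
  have hEc : (q ⁻¹' {x | ¬ContinuousAt α x}).Countable :=
    hDc.preimage (Function.LeftInverse.injective hq₁)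
  refine ⟨fun x₁ x₂ => ?_, ?_⟩
  · have hαsup : ∀ x, |α x| ≤ ⨆ x : ℝ, |α x| :=
      le_ciSup (f := fun x => |α x|) ⟨M, by rintro _ ⟨x, rfl⟩; exact hM x⟩
    have hint := integral_eq_of_hasDerivAt_off_countable σ (fun y => -2 * α (q y)) (a := x₁)
      (b := x₂) hEc (hσg ▸ (hgc.comp hqc).continuousOn)
      (fun y hy => hσd y (not_not.1 hy.2))
      (((hαm.comp hqc.measurable).intervalIntegrable_of_abs_le
        (fun y => hM (q y)) x₁ x₂).const_mul (-2))
    rw [← hint, ← Real.norm_eq_abs]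
    refine intervalIntegral.norm_integral_le_of_norm_le_const fun y _ => ?_
    rw [Real.norm_eq_abs, abs_mul, abs_neg, abs_two]
    exact mul_le_mul_of_nonneg_left (hαsup (q y)) zero_le_two
  · filter_upwards [hEc.ae_notMem volume] with y hy using hσd y (not_not.1 hy)

end
end

section
/- Let α : ℝ → ℝ be a function of bounded variation on ℝ with α(x) → a as x → +∞ and α(x) → b as x → −∞ for some a < 0 < b. Define s(x) = ∫_0^x exp{−2∫_0^z α(y)dy} dz, q = s⁻¹, and σ(y) = exp{−2∫_0^{q(y)} α(z)dz}. Then ∫_{−∞}^{+∞} σ(y)^{−2} dy < ∞. -/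
open MeasureTheory Filter Set

noncomputable section

/-- A function of locally bounded variation on `ℝ` is integrable on every bounded interval. -/
theorem LocallyBoundedVariationOn.intervalIntegrable_univ {f : ℝ → ℝ}
    (hf : LocallyBoundedVariationOn f Set.univ) (u v : ℝ) : IntervalIntegrable f volume u v := by
  obtain ⟨p, r, hp, hr, rfl⟩ := hf.exists_monotoneOn_sub_monotoneOn
  exact (hp.mono (subset_univ _)).intervalIntegrable.sub
    (hr.mono (subset_univ _)).intervalIntegrable

/-- If `f` has a negative limit at `+∞`, the exponential of a positive multiple of its primitive
is integrable at `+∞`. -/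
theorem integrableOn_Ioi_exp_mul_primitive {f : ℝ → ℝ}
    (hf : ∀ u v, IntervalIntegrable f volume u v) {l c : ℝ} (hl : l < 0) (hc : 0 < c)
    (hlim : Tendsto f atTop (nhds l)) :
    IntegrableOn (fun x => Real.exp (c * ∫ y in (0 : ℝ)..x, f y)) (Ioi 0) := by
  have hcont : Continuous fun x => Real.exp (c * ∫ y in (0 : ℝ)..x, f y) :=
    Real.continuous_exp.comp
      (continuous_const.mul (intervalIntegral.continuous_primitive hf 0))
  refine integrable_of_isBigO_exp_neg (b := -(c * (l / 2))) (by nlinarith)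
    hcont.continuousOn ?_
  obtain ⟨M, hM⟩ := eventually_atTop.1 (hlim.eventually_le_const (show l < l / 2 by linarith))
  refine Asymptotics.IsBigO.of_bound
    (Real.exp (c * ((∫ y in (0 : ℝ)..M, f y) - l / 2 * M))) ?_
  filter_upwards [eventually_ge_atTop M] with x hx
  rw [Real.norm_of_nonneg (Real.exp_pos _).le, Real.norm_of_nonneg (Real.exp_pos _).le,
    ← Real.exp_add, Real.exp_le_exp]
  have htail : ∫ y in M..x, f y ≤ l / 2 * (x - M) := by
    have := intervalIntegral.integral_mono_on hx (hf M x)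
      (intervalIntegrable_const (c := l / 2)) fun y hy => hM y hy.1
    rwa [intervalIntegral.integral_const, smul_eq_mul, mul_comm] at this
  have hsplit := intervalIntegral.integral_add_adjacent_intervals (hf 0 M) (hf M x)
  nlinarith [mul_le_mul_of_nonneg_left htail hc.le]

/-- If `f` has a negative limit at `+∞` and a positive limit at `-∞`, the exponential of a
positive multiple of its primitive is integrable on the whole line. -/
theorem integrable_exp_mul_primitive {f : ℝ → ℝ}
    (hf : ∀ u v, IntervalIntegrable f volume u v) {a b c : ℝ} (ha : a < 0) (hb : 0 < b)
    (hc : 0 < c) (hlima : Tendsto f atTop (nhds a)) (hlimb : Tendsto f atBot (nhds b)) :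
    Integrable (fun x => Real.exp (c * ∫ y in (0 : ℝ)..x, f y)) := by
  have hneg : IntegrableOn (fun x => Real.exp (c * ∫ y in (0 : ℝ)..(-x), f y)) (Ioi 0) := by
    have hreflect (u v : ℝ) : IntervalIntegrable (fun x => -f (-x)) volume u v := by
      simpa using! ((IntervalIntegrable.iff_comp_neg (f := f)).1 (hf (-u) (-v))).neg
    refine (integrableOn_Ioi_exp_mul_primitive hreflect (neg_lt_zero.2 hb) hc
      (hlimb.comp tendsto_neg_atTop_atBot).neg).congr_fun (fun x _ => ?_) measurableSet_Ioi
    simp only [intervalIntegral.integral_neg, intervalIntegral.integral_comp_neg, neg_zero]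
    rw [intervalIntegral.integral_symm 0 (-x), neg_neg]
  have hIic := (integrableOn_Ici_iff_integrableOn_Ioi (by finiteness)).2 hneg
  rw [← neg_zero] at hIic
  have hleft : IntegrableOn (fun x => Real.exp (c * ∫ y in (0 : ℝ)..x, f y)) (Iic 0) := by
    simpa only [neg_neg, neg_zero] using hIic.comp_neg_Iic
  rw [← integrableOn_univ, ← Iic_union_Ioi (a := (0 : ℝ))]
  exact hleft.union (integrableOn_Ioi_exp_mul_primitive hf ha hc hlima)

/-- Let `α : ℝ → ℝ` be of bounded variation on `ℝ` with `α(x) → a < 0`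
as `x → +∞` and `α(x) → b > 0` as `x → -∞`. With the scale function
`s(x) = ∫_0^x exp{-2∫_0^z α(y)dy} dz`, its inverse `q = s⁻¹` and
`σ(y) = exp{-2∫_0^{q(y)} α(z)dz}`, one has `∫_{-∞}^{+∞} σ(y)⁻² dy < ∞`. -/
theorem speed_measure_finite
    (α : ℝ → ℝ) (hBV : BoundedVariationOn α Set.univ)
    (a b : ℝ) (ha : a < 0) (hb : 0 < b)
    (hlima : Filter.Tendsto α Filter.atTop (nhds a))
    (hlimb : Filter.Tendsto α Filter.atBot (nhds b))
    (S : ℝ → ℝ) (hS : ∀ x : ℝ, S x = ∫ z in (0:ℝ)..x, Real.exp (-2 * ∫ y in (0:ℝ)..z, α y))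
    (q : ℝ → ℝ) (hq₁ : ∀ y : ℝ, S (q y) = y) (hq₂ : ∀ x : ℝ, q (S x) = x)
    (σ : ℝ → ℝ) (hσ : ∀ y : ℝ, σ y = Real.exp (-2 * ∫ z in (0:ℝ)..(q y), α z)) :
    Integrable (fun y : ℝ => 1 / (σ y) ^ 2) := by
  have hα := hBV.locallyBoundedVariationOn.intervalIntegrable_univ
  have hA : Continuous fun x => Real.exp (-2 * ∫ y in (0 : ℝ)..x, α y) :=
    Real.continuous_exp.comp
      (continuous_const.mul (intervalIntegral.continuous_primitive hα 0))
  have hderiv (x : ℝ) : HasDerivAt S (Real.exp (-2 * ∫ y in (0 : ℝ)..x, α y)) x := by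
    rw [funext hS]
    exact intervalIntegral.integral_hasDerivAt_right (hA.intervalIntegrable _ _)
      (hA.stronglyMeasurableAtFilter _ _) hA.continuousAt
  have hinj : Function.Injective S := Function.LeftInverse.injective hq₂
  have hsurj : Function.Surjective S := Function.RightInverse.surjective hq₁
  rw [← integrableOn_univ, ← image_univ_of_surjective hsurj,
    integrableOn_image_iff_integrableOn_abs_deriv_smul MeasurableSet.univ
      (fun x _ => (hderiv x).hasDerivWithinAt) hinj.injOn, integrableOn_univ]
  refine (integrable_exp_mul_primitive hα ha hb two_pos hlima hlimb).congr
    (ae_of_all _ fun x => ?_)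
  simp only [hσ, hq₂, abs_of_pos (Real.exp_pos _), smul_eq_mul, one_div]
  rw [← Real.exp_nat_mul, ← Real.exp_neg, ← Real.exp_add]
  congr 1
  push_cast
  ring

end
end
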